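/- arXiv:2108.02291 — 2 statements merged into one kernel-verified Lean document; each statement's English description precedes it below -/
import Mathlib

section
/- Let $X$ be a finite dimensional Banach space, $1\le p<\infty$, and $\alpha>0$. Then the Riemann-Liouville fractional integral operator $J^\alpha_{t_0,t}:L^p(t_0,t_1;X)\to L^p(t_0,t_1;X)$ is a compact linear operator. -/
open MeasureTheory Real Set
open scoped ENNReal

/-- The Riemann-Liouville fractional integral of order `α` based at `t₀`. -/
noncomputable def RL {X : Type*} [NormedAddCommGroup X] [NormedSpace ℝ X]
    (α t₀ : ℝ) (f : ℝ → X) (t : ℝ) : X :=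
  (Real.Gamma α)⁻¹ • ∫ s in t₀..t, (t - s) ^ (α - 1) • f s

theorem isCompactOperator_of_finiteDimensional_approx {E F : Type*} [NormedAddCommGroup E]
    [NormedSpace ℝ E] [NormedAddCommGroup F] [NormedSpace ℝ F] [CompleteSpace F] (T : E →L[ℝ] F)
    (h : ∀ ε > 0, ∃ V : Submodule ℝ F, FiniteDimensional ℝ V ∧
      ∀ x, ∃ v ∈ V, ‖T x - v‖ ≤ ε * ‖x‖) :
    IsCompactOperator T := by
  refine (isCompactOperator_iff_isCompact_closure_image_closedBall (T : E →ₗ[ℝ] F) one_pos).2 ?_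
  refine TotallyBounded.isCompact_of_isClosed (TotallyBounded.closure ?_) isClosed_closure
  refine Metric.totallyBounded_iff.2 fun ε hε => ?_
  obtain ⟨V, hV, hTV⟩ := h (ε / 2) (half_pos hε)
  have hK : IsCompact (V.subtype '' Metric.closedBall 0 (‖T‖ + ε / 2)) :=
    (isCompact_closedBall _ _).image V.subtypeL.continuous
  obtain ⟨N, hN, hKN⟩ := Metric.totallyBounded_iff.1 hK.totallyBounded (ε / 2) (half_pos hε)
  refine ⟨N, hN, ?_⟩
  rintro _ ⟨x, hx, rfl⟩
  obtain ⟨v, hvV, hv⟩ := hTV x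
  have hx1 : ‖x‖ ≤ 1 := by simpa using hx
  have hv' : ‖T x - v‖ ≤ ε / 2 := hv.trans (by nlinarith)
  have hvn : ‖v‖ ≤ ‖T‖ + ε / 2 := by
    calc ‖v‖ = ‖T x - (T x - v)‖ := by simp
      _ ≤ ‖T x‖ + ‖T x - v‖ := norm_sub_le _ _
      _ ≤ ‖T‖ + ε / 2 := add_le_add (T.unit_le_opNorm x hx1) hv'
  obtain ⟨y, hy, hvy⟩ := mem_iUnion₂.1 (hKN ⟨⟨v, hvV⟩, by simpa using hvn, rfl⟩)
  refine mem_iUnion₂.2 ⟨y, hy, ?_⟩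
  have h1 : dist (T x) v ≤ ε / 2 := by rwa [dist_eq_norm]
  have h2 : dist v y < ε / 2 := hvy
  change dist (T x) y < ε
  linarith [dist_triangle (T x) v y]

theorem lintegral_rpow_lintegral_sub_mul_le {μ : Measure ℝ} [SFinite μ] (hμ : μ ≤ volume)
    {H F : ℝ → ℝ≥0∞} (hH : Measurable H) (hF : AEMeasurable F μ) {r : ℝ} (hr : 1 ≤ r) :
    ∫⁻ t, (∫⁻ s, H (t - s) * F s ∂μ) ^ r ∂μ ≤ (∫⁻ u, H u) ^ r * ∫⁻ s, F s ^ r ∂μ := by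
  have hr0 : 0 < r := one_pos.trans_le hr
  have hr1 : 0 ≤ 1 - r⁻¹ := sub_nonneg.2 (inv_le_one_of_one_le₀ hr)
  have hHs (t : ℝ) : Measurable fun s => H (t - s) := hH.comp (measurable_const.sub measurable_id)
  have holder (t : ℝ) : (∫⁻ s, H (t - s) * F s ∂μ) ^ r ≤
      (∫⁻ u, H u) ^ (r - 1) * ∫⁻ s, H (t - s) * F s ^ r ∂μ := by
    have h1 : ∫⁻ s, H (t - s) * F s ∂μ ≤
        (∫⁻ s, H (t - s) ∂μ) ^ (1 - r⁻¹) * (∫⁻ s, H (t - s) * F s ^ r ∂μ) ^ r⁻¹ := by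
      refine le_trans (le_of_eq (lintegral_congr fun s => ?_)) (ENNReal.lintegral_mul_norm_pow_le
        (hHs t).aemeasurable ((hHs t).aemeasurable.mul (hF.pow_const r)) hr1
        (inv_nonneg.2 hr0.le) (by ring))
      rw [Pi.mul_apply, ENNReal.mul_rpow_of_nonneg _ _ (inv_nonneg.2 hr0.le), ← mul_assoc,
        ← ENNReal.rpow_add_of_nonneg _ _ hr1 (inv_nonneg.2 hr0.le), ENNReal.rpow_rpow_inv hr0.ne']
      simp
    have h2 : ∫⁻ s, H (t - s) ∂μ ≤ ∫⁻ u, H u :=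
      (lintegral_mono' hμ le_rfl).trans (lintegral_sub_left_eq_self H t).le
    calc _ ≤ ((∫⁻ u, H u) ^ (1 - r⁻¹) * (∫⁻ s, H (t - s) * F s ^ r ∂μ) ^ r⁻¹) ^ r := by
          gcongr; exact h1.trans (by gcongr)
      _ = _ := by
          rw [ENNReal.mul_rpow_of_nonneg _ _ hr0.le, ENNReal.rpow_inv_rpow hr0.ne',
            ← ENNReal.rpow_mul]
          congr 2
          field_simp
  calc _ ≤ ∫⁻ t, (∫⁻ u, H u) ^ (r - 1) * ∫⁻ s, H (t - s) * F s ^ r ∂μ ∂μ := lintegral_mono holder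
    _ = (∫⁻ u, H u) ^ (r - 1) * ∫⁻ t, ∫⁻ s, H (t - s) * F s ^ r ∂μ ∂μ := by
      refine lintegral_const_mul'' _ ?_
      refine AEMeasurable.lintegral_prod_right' (f := fun z : ℝ × ℝ => H (z.1 - z.2) * F z.2 ^ r) ?_
      exact (hH.comp measurable_sub).aemeasurable.mul (hF.pow_const r).comp_snd
    _ = (∫⁻ u, H u) ^ (r - 1) * ∫⁻ s, ∫⁻ t, H (t - s) * F s ^ r ∂μ ∂μ := by
      rw [lintegral_lintegral_swap]
      exact (hH.comp measurable_sub).aemeasurable.mul (hF.pow_const r).comp_snd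
    _ ≤ (∫⁻ u, H u) ^ (r - 1) * ∫⁻ s, (∫⁻ u, H u) * F s ^ r ∂μ := by
      gcongr with s
      have hHt : Measurable fun t => H (t - s) := hH.comp (measurable_id.sub_const s)
      rw [lintegral_mul_const _ hHt]
      exact mul_le_mul_left
        ((lintegral_mono' hμ le_rfl).trans (lintegral_sub_right_eq_self H s).le) _
    _ = _ := by
      rw [lintegral_const_mul'' _ (hF.pow_const r), ← mul_assoc]
      congr 1
      nth_rw 2 [← ENNReal.rpow_one (∫⁻ u, H u)]
      rw [← ENNReal.rpow_add_of_nonneg _ _ (sub_nonneg.2 hr) zero_le_one, sub_add_cancel]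

theorem exists_polynomial_lintegral_sub_le {a b : ℝ} {k : ℝ → ℝ}
    (hk : IntegrableOn k (Icc a b)) {ε : ℝ} (hε : 0 < ε) :
    ∃ q : Polynomial ℝ, ∫⁻ u in Icc a b, ‖k u - q.eval u‖ₑ ≤ ENNReal.ofReal ε := by
  obtain ⟨g, -, hkg, hg, -⟩ := hk.exists_hasCompactSupport_lintegral_sub_le
    (ε := ENNReal.ofReal (ε / 2)) (by simpa using hε)
  set δ := ε / 2 / (|b - a| + 1) with hδ
  have hδ0 : 0 < δ := by positivity
  obtain ⟨q, hq⟩ := exists_polynomial_near_of_continuousOn a b g hg.continuousOn δ hδ0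
  refine ⟨q, ?_⟩
  calc _ ≤ ∫⁻ u in Icc a b, (‖k u - g u‖ₑ + ENNReal.ofReal δ) := by
        refine setLIntegral_mono' measurableSet_Icc fun u hu => ?_
        rw [← sub_add_sub_cancel (k u) (g u) (q.eval u)]
        refine (enorm_add_le _ _).trans ?_
        gcongr
        rw [← ofReal_norm, norm_sub_rev]
        exact ENNReal.ofReal_le_ofReal (hq u hu).le
    _ = (∫⁻ u in Icc a b, ‖k u - g u‖ₑ) + ENNReal.ofReal δ * ENNReal.ofReal (b - a) := by
        rw [lintegral_add_right _ measurable_const]; simp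
    _ ≤ ENNReal.ofReal (ε / 2) + ENNReal.ofReal (ε / 2) := by
        gcongr
        rw [← ENNReal.ofReal_mul hδ0.le]
        refine ENNReal.ofReal_le_ofReal ?_
        rw [hδ, div_mul_eq_mul_div, div_le_iff₀ (by positivity)]
        have := le_abs_self (b - a)
        gcongr
        linarith
    _ = ENNReal.ofReal ε := by
        rw [← ENNReal.ofReal_add (by positivity) (by positivity), add_halves]

theorem sub_mem_Icc_sub_sub {a b t s : ℝ} (ht : t ∈ Icc a b) (hs : s ∈ Icc a b) :
    t - s ∈ Icc (a - b) (b - a) :=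
  ⟨by linarith [ht.1, hs.2], by linarith [ht.2, hs.1]⟩

section Convolution

variable {X : Type*} [NormedAddCommGroup X] [NormedSpace ℝ X] {a b : ℝ}

theorem setLIntegral_rpow_setLIntegral_enorm_sub_smul_le {k : ℝ → ℝ} {f : ℝ → X}
    (hk : Measurable k) (hf : AEStronglyMeasurable f (volume.restrict (Icc a b))) {r : ℝ}
    (hr : 1 ≤ r) :
    ∫⁻ t in Icc a b, (∫⁻ s in Icc a b, ‖k (t - s) • f s‖ₑ) ^ r ≤
      (∫⁻ u in Icc (a - b) (b - a), ‖k u‖ₑ) ^ r * ∫⁻ s in Icc a b, ‖f s‖ₑ ^ r := by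
  rw [← lintegral_indicator (μ := volume) (s := Icc (a - b) (b - a)) measurableSet_Icc]
  refine le_trans (le_of_eq ?_) (lintegral_rpow_lintegral_sub_mul_le Measure.restrict_le_self
    (hk.enorm.indicator measurableSet_Icc) hf.enorm hr)
  refine setLIntegral_congr_fun measurableSet_Icc fun t ht => ?_
  refine congrArg (· ^ r) (setLIntegral_congr_fun measurableSet_Icc fun s hs => ?_)
  rw [enorm_smul, indicator_of_mem (sub_mem_Icc_sub_sub ht hs)]

theorem ae_integrableOn_sub_smul {k : ℝ → ℝ} {f : ℝ → X} (hk : Measurable k)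
    (hkJ : IntegrableOn k (Icc (a - b) (b - a))) (hf : IntegrableOn f (Icc a b)) :
    ∀ᵐ t ∂volume.restrict (Icc a b), IntegrableOn (fun s => k (t - s) • f s) (Icc a b) := by
  have hlt : ∫⁻ t in Icc a b, ∫⁻ s in Icc a b, ‖k (t - s) • f s‖ₑ < ⊤ := by
    have h := setLIntegral_rpow_setLIntegral_enorm_sub_smul_le hk hf.aestronglyMeasurable le_rfl
    simp only [ENNReal.rpow_one] at h
    exact h.trans_lt (ENNReal.mul_lt_top hkJ.2 hf.2)
  have hm : AEStronglyMeasurable (fun z : ℝ × ℝ => k (z.1 - z.2) • f z.2)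
      ((volume.restrict (Icc a b)).prod (volume.restrict (Icc a b))) :=
    (hk.comp measurable_sub).aestronglyMeasurable.smul hf.aestronglyMeasurable.comp_snd
  filter_upwards [ae_lt_top' hm.enorm.lintegral_prod_right' hlt.ne] with t ht
  exact ⟨(hk.comp (measurable_const.sub measurable_id)).aestronglyMeasurable.smul
    hf.aestronglyMeasurable, ht⟩

theorem eLpNorm_setIntegral_sub_smul_le {k : ℝ → ℝ} {f : ℝ → X} {p : ℝ≥0∞} (hk : Measurable k)
    (hf : AEStronglyMeasurable f (volume.restrict (Icc a b))) (hp : 1 ≤ p) (hp' : p ≠ ⊤) :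
    eLpNorm (fun t => ∫ s in Icc a b, k (t - s) • f s) p (volume.restrict (Icc a b)) ≤
      (∫⁻ u in Icc (a - b) (b - a), ‖k u‖ₑ) * eLpNorm f p (volume.restrict (Icc a b)) := by
  have hp0 : p ≠ 0 := (one_pos.trans_le hp).ne'
  have hr : 1 ≤ p.toReal := by simpa using ENNReal.toReal_mono hp' hp
  have hr0 : 0 < p.toReal := one_pos.trans_le hr
  rw [eLpNorm_eq_lintegral_rpow_enorm_toReal hp0 hp', eLpNorm_eq_lintegral_rpow_enorm_toReal hp0 hp',
    one_div, ENNReal.rpow_inv_le_iff hr0, ENNReal.mul_rpow_of_nonneg _ _ hr0.le,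
    ENNReal.rpow_inv_rpow hr0.ne']
  refine le_trans (lintegral_mono fun t => ?_)
    (setLIntegral_rpow_setLIntegral_enorm_sub_smul_le hk hf hr)
  gcongr
  exact enorm_integral_le_lintegral_enorm _

theorem memLp_sum_pow_smul (p : ℝ≥0∞) {n : ℕ} (x : Fin n → X) :
    MemLp (fun t : ℝ => ∑ j : Fin n, t ^ (j : ℕ) • x j) p (volume.restrict (Icc a b)) := by
  have hc : Continuous fun t : ℝ => ∑ j : Fin n, t ^ (j : ℕ) • x j := by fun_prop
  obtain ⟨C, hC⟩ := isCompact_Icc.exists_bound_of_continuousOn (s := Icc a b) hc.continuousOn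
  exact MemLp.of_bound hc.aestronglyMeasurable C
    ((ae_restrict_iff' measurableSet_Icc).2 (.of_forall hC))

/-- The linear map sending a family of coefficients to the corresponding vector-valued polynomial
function, as an element of `Lᵖ(a, b; X)`. -/
noncomputable def polynomialLp (X : Type*) [NormedAddCommGroup X] [NormedSpace ℝ X] (a b : ℝ)
    (p : ℝ≥0∞) (n : ℕ) : (Fin n → X) →ₗ[ℝ] Lp X p (volume.restrict (Icc a b)) where
  toFun x := (memLp_sum_pow_smul p x).toLp
  map_add' x y := by
    rw [← MemLp.toLp_add]
    refine MemLp.toLp_congr _ _ (.of_forall fun t => ?_)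
    simp [smul_add, Finset.sum_add_distrib]
  map_smul' c x := by
    rw [RingHom.id_apply, ← MemLp.toLp_const_smul]
    refine MemLp.toLp_congr _ _ (.of_forall fun t => ?_)
    simp [Finset.smul_sum, smul_comm c]

theorem setIntegral_eval_sub_smul (q : Polynomial ℝ) {f : ℝ → X} (hf : IntegrableOn f (Icc a b))
    (t : ℝ) :
    ∫ s in Icc a b, q.eval (t - s) • f s = ∑ j : Fin (q.natDegree + 1),
      t ^ (j : ℕ) • ∫ s in Icc a b, (Polynomial.hasseDeriv j q).eval (-s) • f s := by
  have hint (j : ℕ) :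
      IntegrableOn (fun s => (Polynomial.hasseDeriv j q).eval (-s) • f s) (Icc a b) :=
    hf.continuousOn_smul (by fun_prop) isCompact_Icc
  simp only [← integral_smul]
  rw [← integral_finsetSum _ fun (j : Fin (q.natDegree + 1)) _ => (hint j).fun_smul (t ^ (j : ℕ))]
  congr 1 with s
  rw [sub_eq_add_neg, ← Polynomial.taylor_eval, Polynomial.eval_eq_sum_range,
    Polynomial.natDegree_taylor, Finset.sum_range, Finset.sum_smul]
  simp only [Polynomial.taylor_coeff, smul_smul, mul_comm]

/-- A convolution operator with integrable kernel on a bounded interval is compact on `Lᵖ`. -/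
theorem isCompactOperator_of_ae_eq_setIntegral_sub_smul [FiniteDimensional ℝ X]
    {p : ℝ≥0∞} [hp : Fact (1 ≤ p)] (hp' : p ≠ ⊤) {k : ℝ → ℝ} (hk : Measurable k)
    (hkJ : IntegrableOn k (Icc (a - b) (b - a)))
    (T : Lp X p (volume.restrict (Icc a b)) →L[ℝ] Lp X p (volume.restrict (Icc a b)))
    (hT : ∀ f : Lp X p (volume.restrict (Icc a b)),
      T f =ᵐ[volume.restrict (Icc a b)] fun t => ∫ s in Icc a b, k (t - s) • f s) :
    IsCompactOperator T := by
  have : CompleteSpace X := FiniteDimensional.complete ℝ X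
  refine isCompactOperator_of_finiteDimensional_approx T fun ε hε => ?_
  obtain ⟨q, hq⟩ := exists_polynomial_lintegral_sub_le hkJ hε
  refine ⟨LinearMap.range (polynomialLp X a b p (q.natDegree + 1)), inferInstance, fun f => ?_⟩
  have hf : IntegrableOn f (Icc a b) := (Lp.memLp f).integrable hp.out
  refine ⟨polynomialLp X a b p _ fun j =>
    ∫ s in Icc a b, (Polynomial.hasseDeriv j q).eval (-s) • f s, ⟨_, rfl⟩, ?_⟩
  set v := polynomialLp X a b p (q.natDegree + 1) fun j =>
    ∫ s in Icc a b, (Polynomial.hasseDeriv j q).eval (-s) • f s with hv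
  have hvt : v =ᵐ[volume.restrict (Icc a b)] fun t => ∫ s in Icc a b, q.eval (t - s) • f s := by
    filter_upwards [(memLp_sum_pow_smul (a := a) (b := b) p fun j : Fin (q.natDegree + 1) =>
      ∫ s in Icc a b, (Polynomial.hasseDeriv j q).eval (-s) • f s).coeFn_toLp] with t ht
    rw [setIntegral_eval_sub_smul q hf]
    exact ht
  have hqm : Measurable fun u => q.eval u := q.continuous.measurable
  have hdiff : (T f - v : Lp X p _) =ᵐ[volume.restrict (Icc a b)]
      fun t => ∫ s in Icc a b, (k (t - s) - q.eval (t - s)) • f s := by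
    filter_upwards [Lp.coeFn_sub (T f) v, hT f, hvt, ae_integrableOn_sub_smul hk hkJ hf,
      ae_integrableOn_sub_smul hqm q.continuous.continuousOn.integrableOn_Icc hf]
      with t h1 h2 h3 h4 h5
    rw [h1, Pi.sub_apply, h2, h3, ← integral_sub h4 h5]
    simp only [sub_smul]
  rw [Lp.norm_def, Lp.norm_def, eLpNorm_congr_ae hdiff, ← ENNReal.toReal_ofReal hε.le,
    ← ENNReal.toReal_mul]
  refine ENNReal.toReal_mono (ENNReal.mul_ne_top ENNReal.ofReal_ne_top (Lp.eLpNorm_ne_top f)) ?_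
  refine (eLpNorm_setIntegral_sub_smul_le (k := fun u => k u - q.eval u) (hk.sub hqm)
    hf.aestronglyMeasurable hp.out hp').trans ?_
  gcongr

end Convolution

theorem RL_eq_setIntegral {X : Type*} [NormedAddCommGroup X] [NormedSpace ℝ X] (α : ℝ) {a b t : ℝ}
    (ht : t ∈ Icc a b) (f : ℝ → X) :
    RL α a f t = ∫ s in Icc a b,
      (Ici 0).indicator (fun u => (Real.Gamma α)⁻¹ * u ^ (α - 1)) (t - s) • f s := by
  have h (s : ℝ) : (Ici 0).indicator (fun u => (Real.Gamma α)⁻¹ * u ^ (α - 1)) (t - s) • f s =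
      (Iic t).indicator (fun s => (Real.Gamma α)⁻¹ • (t - s) ^ (α - 1) • f s) s := by
    by_cases hs : s ≤ t <;> simp [hs, mul_smul]
  simp only [h]
  rw [setIntegral_indicator measurableSet_Iic, ← Ici_inter_Iic, inter_assoc, Iic_inter_Iic,
    inf_of_le_right ht.2, Ici_inter_Iic,
    integral_smul, integral_Icc_eq_integral_Ioc, ← intervalIntegral.integral_of_le ht.1, RL]

theorem integrableOn_indicator_Ici_rpow {α : ℝ} (hα : 0 < α) (c L : ℝ) :
    IntegrableOn ((Ici 0).indicator fun u : ℝ => c * u ^ (α - 1)) (Icc (-L) L) := by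
  rw [IntegrableOn, integrable_indicator_iff measurableSet_Ici, IntegrableOn,
    Measure.restrict_restrict measurableSet_Ici]
  have h : IntegrableOn (fun u : ℝ => u ^ (α - 1)) (Icc 0 |L|) := by
    rw [integrableOn_Icc_iff_integrableOn_Ioc, ← intervalIntegrable_iff_integrableOn_Ioc_of_le
      (abs_nonneg L)]
    exact intervalIntegral.intervalIntegrable_rpow' (by linarith)
  exact IntegrableOn.mono_set (h.const_mul c) fun u hu => ⟨hu.1, hu.2.2.trans (le_abs_self L)⟩

/-- If `X` is finite dimensional, any bounded operator on `Lᵖ(t₀,t₁;X)` (with `1 ≤ p < ∞`)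
realizing the RL fractional integral of order `α > 0` is a compact operator. -/
theorem rl_isCompactOperator_of_finiteDimensional {X : Type*} [NormedAddCommGroup X]
    [NormedSpace ℝ X] [CompleteSpace X] [FiniteDimensional ℝ X]
    (t₀ t₁ α : ℝ) (ht : t₀ < t₁) (hα : 0 < α)
    (p : ℝ≥0∞) [Fact (1 ≤ p)] (hp' : p ≠ ⊤)
    (T : Lp X p (volume.restrict (Set.Icc t₀ t₁)) →L[ℝ]
         Lp X p (volume.restrict (Set.Icc t₀ t₁)))
    (hT : ∀ f : Lp X p (volume.restrict (Set.Icc t₀ t₁)),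
      (T f : ℝ → X) =ᵐ[volume.restrict (Set.Icc t₀ t₁)] RL α t₀ (f : ℝ → X)) :
    IsCompactOperator T := by
  have hk : Measurable ((Ici 0).indicator fun u : ℝ => (Real.Gamma α)⁻¹ * u ^ (α - 1)) :=
    ((measurable_id.pow_const _).const_mul _).indicator measurableSet_Ici
  refine isCompactOperator_of_ae_eq_setIntegral_sub_smul hp' hk ?_ T fun f => ?_
  · rw [← neg_sub t₁ t₀]
    exact integrableOn_indicator_Ici_rpow hα _ _
  · filter_upwards [hT f, ae_restrict_mem measurableSet_Icc] with t h ht'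
    rw [h, RL_eq_setIntegral α ht']
end

section
/- Let $X$ be a Banach space, $1\le p<\infty$, and $\alpha>0$. The bounded operator $J^\alpha_{t_0,t}:L^p(t_0,t_1;X)\to L^p(t_0,t_1;X)$ is compact if and only if for every bounded set $F\subset L^p(t_0,t_1;X)$ and all $t_0<t_0^*<t_1^*<t_1$, the set $\{J^{1+\alpha}_{t_0,t_1^*}f(t_1^*)-J^{1+\alpha}_{t_0,t_0^*}f(t_0^*):f\in F\}$ is relatively compact in $X$. -/
open MeasureTheory Real Set
open scoped ENNReal

/-- **Schur's test** for nonnegative kernels. -/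
theorem lintegral_kernel_rpow_le {Ω : Type*} [MeasurableSpace Ω] {μ : Measure Ω} [SFinite μ]
    {K : Ω → Ω → ℝ≥0∞} (hK : Measurable (Function.uncurry K)) {g : Ω → ℝ≥0∞}
    (hg : AEMeasurable g μ) {C : ℝ≥0∞} (hrow : ∀ t, ∫⁻ s, K t s ∂μ ≤ C)
    (hcol : ∀ s, ∫⁻ t, K t s ∂μ ≤ C) {p : ℝ} (hp : 1 ≤ p) :
    ∫⁻ t, (∫⁻ s, K t s * g s ∂μ) ^ p ∂μ ≤ C ^ p * ∫⁻ s, g s ^ p ∂μ := by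
  have hp0 : 0 < p := by linarith
  have hpinv : p⁻¹ ≤ 1 := inv_le_one_of_one_le₀ hp
  have hpt : ∀ t, (∫⁻ s, K t s * g s ∂μ) ^ p ≤ C ^ (p - 1) * ∫⁻ s, K t s * g s ^ p ∂μ := by
    intro t
    have hKt : Measurable (K t) := hK.of_uncurry_left
    have holder := ENNReal.lintegral_mul_norm_pow_le (μ := μ) (f := K t)
      (g := fun s => K t s * g s ^ p) hKt.aemeasurable
      (hKt.aemeasurable.mul (hg.pow_const p)) (p := 1 - p⁻¹) (q := p⁻¹)
      (by linarith) (by positivity) (by ring)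
    have hsplit : ∀ s, K t s ^ (1 - p⁻¹) * (K t s * g s ^ p) ^ p⁻¹ = K t s * g s := by
      intro s
      rw [ENNReal.mul_rpow_of_nonneg _ _ (by positivity), ← mul_assoc,
        ← ENNReal.rpow_add_of_nonneg _ _ (by linarith) (by positivity), ← ENNReal.rpow_mul,
        mul_inv_cancel₀ hp0.ne']
      simp
    simp_rw [hsplit] at holder
    calc (∫⁻ s, K t s * g s ∂μ) ^ p
        ≤ ((∫⁻ s, K t s ∂μ) ^ (1 - p⁻¹) * (∫⁻ s, K t s * g s ^ p ∂μ) ^ p⁻¹) ^ p := by gcongr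
      _ = (∫⁻ s, K t s ∂μ) ^ (p - 1) * ∫⁻ s, K t s * g s ^ p ∂μ := by
          rw [ENNReal.mul_rpow_of_nonneg _ _ hp0.le, ← ENNReal.rpow_mul, ← ENNReal.rpow_mul,
            inv_mul_cancel₀ hp0.ne', ENNReal.rpow_one]
          field_simp
      _ ≤ _ := by
          gcongr
          exact hrow t
  have hmeas : AEMeasurable (Function.uncurry fun t s => K t s * g s ^ p) (μ.prod μ) :=
    hK.aemeasurable.mul ((hg.pow_const p).comp_quasiMeasurePreserving
      Measure.quasiMeasurePreserving_snd)
  calc ∫⁻ t, (∫⁻ s, K t s * g s ∂μ) ^ p ∂μ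
      ≤ ∫⁻ t, C ^ (p - 1) * ∫⁻ s, K t s * g s ^ p ∂μ ∂μ := lintegral_mono hpt
    _ = C ^ (p - 1) * ∫⁻ t, ∫⁻ s, K t s * g s ^ p ∂μ ∂μ := by
        exact lintegral_const_mul'' _ hmeas.lintegral_prod_right'
    _ = C ^ (p - 1) * ∫⁻ s, (∫⁻ t, K t s ∂μ) * g s ^ p ∂μ := by
        rw [lintegral_lintegral_swap hmeas]
        congr 1
        refine lintegral_congr fun s => ?_
        rw [lintegral_mul_const _ hK.of_uncurry_right]
    _ ≤ C ^ (p - 1) * ∫⁻ s, C * g s ^ p ∂μ := by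
        gcongr with s
        exact hcol s
    _ = C ^ p * ∫⁻ s, g s ^ p ∂μ := by
        rw [lintegral_const_mul'' _ (hg.pow_const p), ← mul_assoc]
        congr 1
        conv_lhs => rw [← ENNReal.rpow_one C]
        rw [← ENNReal.rpow_mul, ← ENNReal.rpow_add_of_nonneg _ _ (by linarith) (by norm_num)]
        congr 1; ring

section

variable {X : Type*} [NormedAddCommGroup X] {p : ℝ≥0∞}

/-- Schur's test for operators on `Lᵖ` dominated by a nonnegative kernel. -/
theorem Lp.norm_le_of_enorm_le_kernel {Ω : Type*} [MeasurableSpace Ω] {μ : Measure Ω} [SFinite μ]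
    [hp : Fact (1 ≤ p)] (hp' : p ≠ ⊤)
    {K : Ω → Ω → ℝ≥0∞} (hK : Measurable (Function.uncurry K)) {C : ℝ} (hC : 0 ≤ C)
    (hrow : ∀ t, ∫⁻ s, K t s ∂μ ≤ ENNReal.ofReal C)
    (hcol : ∀ s, ∫⁻ t, K t s ∂μ ≤ ENNReal.ofReal C)
    (f g : Lp X p μ) (h : ∀ᵐ t ∂μ, ‖g t‖ₑ ≤ ∫⁻ s, K t s * ‖f s‖ₑ ∂μ) :
    ‖g‖ ≤ C * ‖f‖ := by
  have hp0 : p ≠ 0 := (zero_lt_one.trans_le hp.out).ne'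
  have hp1 : 1 ≤ p.toReal := by
    simpa using ENNReal.toReal_mono hp' hp.out
  have key : eLpNorm g p μ ≤ ENNReal.ofReal C * eLpNorm f p μ := by
    rw [eLpNorm_eq_lintegral_rpow_enorm_toReal hp0 hp', eLpNorm_eq_lintegral_rpow_enorm_toReal hp0 hp']
    calc (∫⁻ t, ‖g t‖ₑ ^ p.toReal ∂μ) ^ (1 / p.toReal)
        ≤ (∫⁻ t, (∫⁻ s, K t s * ‖f s‖ₑ ∂μ) ^ p.toReal ∂μ) ^ (1 / p.toReal) := by
          gcongr ?_ ^ _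
          refine lintegral_mono_ae ?_
          filter_upwards [h] with t ht
          gcongr
      _ ≤ (ENNReal.ofReal C ^ p.toReal * ∫⁻ s, ‖f s‖ₑ ^ p.toReal ∂μ) ^ (1 / p.toReal) := by
          gcongr
          exact lintegral_kernel_rpow_le hK (Lp.aestronglyMeasurable f).enorm hrow hcol hp1
      _ = _ := by
          rw [ENNReal.mul_rpow_of_nonneg _ _ (by positivity), ← ENNReal.rpow_mul,
            mul_one_div_cancel (by linarith), ENNReal.rpow_one]
  rw [Lp.norm_def, Lp.norm_def]
  calc _ ≤ (ENNReal.ofReal C * eLpNorm f p μ).toReal :=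
        ENNReal.toReal_mono (ENNReal.mul_ne_top ENNReal.ofReal_ne_top (Lp.eLpNorm_ne_top f)) key
    _ = _ := by rw [ENNReal.toReal_mul, ENNReal.toReal_ofReal hC]

variable [NormedSpace ℝ X]

/-- Integration against a bounded measurable weight is a bounded functional on `Lᵖ`. -/
theorem Lp.exists_clm_eq_integral_smul [CompleteSpace X] {Ω : Type*} [MeasurableSpace Ω]
    {μ : Measure Ω} [IsFiniteMeasure μ] [hp : Fact (1 ≤ p)] {w : Ω → ℝ} (hw : Measurable w)
    {M : ℝ} (hM : ∀ᵐ s ∂μ, ‖w s‖ ≤ M) :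
    ∃ B : Lp X p μ →L[ℝ] X, ∀ f : Lp X p μ, B f = ∫ s, w s • f s ∂μ := by
  have : ENNReal.HolderConjugate (ENNReal.conjExponent p) p :=
    (ENNReal.HolderConjugate.conjExponent hp.out).symm
  have : Fact (1 ≤ ENNReal.conjExponent p) := ⟨ENNReal.HolderConjugate.one_le _ p⟩
  have hw' : MemLp w (ENNReal.conjExponent p) μ := .of_bound hw.aestronglyMeasurable M hM
  refine ⟨(ContinuousLinearMap.lsmul ℝ ℝ).lpPairing μ (ENNReal.conjExponent p) p hw'.toLp,
    fun f => ?_⟩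
  rw [ContinuousLinearMap.lpPairing_eq_integral]
  refine integral_congr_ae ?_
  filter_upwards [hw'.coeFn_toLp] with s hs
  simp [hs]

/-- Extension of a vector by a constant multiple of an indicator function, as a linear map. -/
noncomputable def indicatorConstLpₗ {Ω : Type*} [MeasurableSpace Ω] (p : ℝ≥0∞) (μ : Measure Ω)
    [IsFiniteMeasure μ] {A : Set Ω} (hA : MeasurableSet A) : X →ₗ[ℝ] Lp X p μ where
  toFun x := indicatorConstLp p hA (measure_ne_top μ A) x
  map_add' _ _ := indicatorConstLp_add.symm
  map_smul' c x := by
    simp only [indicatorConstLp, RingHom.id_apply, ← MemLp.toLp_const_smul]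
    congr 1
    exact indicator_const_smul A c fun _ => x

/-- On a finite-dimensional space, a kernel sampled on a grid in its first variable gives a compact
operator. -/
theorem exists_isCompactOperator_grid [FiniteDimensional ℝ X] [Fact (1 ≤ p)] (a b : ℝ)
    {φ : ℝ → ℝ} (hφ : Measurable φ) {M : ℝ} (hM : ∀ u, ‖φ u‖ ≤ M) {δ : ℝ} (hδ : 0 < δ) :
    ∃ S : Lp X p (volume.restrict (Icc a b)) →L[ℝ] Lp X p (volume.restrict (Icc a b)),
      IsCompactOperator S ∧ ∀ f : Lp X p (volume.restrict (Icc a b)),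
        S f =ᵐ[volume.restrict (Icc a b)]
          fun t => ∫ s in Icc a b, φ (δ * ⌊t / δ⌋ - s) • f s := by
  have : CompleteSpace X := FiniteDimensional.complete ℝ X
  have : ProperSpace X := FiniteDimensional.proper ℝ X
  let A : ℤ → Set ℝ := fun i => {t | ⌊t / δ⌋ = i}
  have hA : ∀ i, MeasurableSet (A i) := fun i =>
    (Int.measurable_floor.comp (measurable_id.div_const δ)) (measurableSet_singleton i)
  choose B hB using fun i : ℤ => Lp.exists_clm_eq_integral_smul (X := X) (p := p)
    (μ := volume.restrict (Icc a b)) (w := fun s => φ (δ * i - s))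
    (hφ.comp (measurable_const.sub measurable_id)) (M := M) (.of_forall fun s => hM _)
  let J := Finset.Icc ⌊a / δ⌋ ⌊b / δ⌋
  let E : ℤ → X →L[ℝ] Lp X p (volume.restrict (Icc a b)) := fun i =>
    (indicatorConstLpₗ p (volume.restrict (Icc a b)) (hA i)).toContinuousLinearMap
  refine ⟨∑ i ∈ J, E i ∘L B i, ?_, fun f => ?_⟩
  · refine Submodule.sum_mem
      (compactOperator (RingHom.id ℝ) (Lp X p (volume.restrict (Icc a b)))
        (Lp X p (volume.restrict (Icc a b)))) fun i _ => ?_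
    exact (isCompactOperator_of_locallyCompactSpace_dom (B i)).clm_comp (E i)
  · have hE : ∀ᵐ t ∂volume.restrict (Icc a b), ∀ i : ℤ,
        E i (B i f) t = (A i).indicator (fun _ => B i f) t :=
      ae_all_iff.2 fun i =>
        indicatorConstLp_coeFn (hs := hA i) (hμs := measure_ne_top _ _)
    have hsum : (((∑ i ∈ J, E i ∘L B i) f : Lp X p (volume.restrict (Icc a b))) : ℝ → X)
        =ᵐ[volume.restrict (Icc a b)] fun t => ∑ i ∈ J, E i (B i f) t := by
      have := Lp.coeFn_finsetSum J (fun i => E i (B i f))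
      simp only [_root_.sum_apply, ContinuousLinearMap.comp_apply]
      filter_upwards [this] with t ht
      rw [ht]; simp
    filter_upwards [hE, hsum, ae_restrict_mem measurableSet_Icc] with t ht hs htm
    rw [hs, Finset.sum_eq_single ⌊t / δ⌋]
    · rw [ht, indicator_of_mem (show t ∈ A ⌊t / δ⌋ from rfl), hB]
    · intro i _ hi
      rw [ht, indicator_of_notMem]
      exact fun h => hi (Eq.symm h)
    · intro h
      refine absurd (Finset.mem_Icc.2 ⟨?_, ?_⟩) h <;> gcongr
      exacts [htm.1, htm.2]

/-- On a finite-dimensional space, convolution with an integrable kernel is a compact operator. -/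
theorem isCompactOperator_of_convolution [FiniteDimensional ℝ X] [hp : Fact (1 ≤ p)] (hp' : p ≠ ⊤)
    {a b : ℝ} {k : ℝ → ℝ} (hkm : Measurable k) (hk : Integrable k)
    (T : Lp X p (volume.restrict (Icc a b)) →L[ℝ] Lp X p (volume.restrict (Icc a b)))
    (hT : ∀ f : Lp X p (volume.restrict (Icc a b)),
      T f =ᵐ[volume.restrict (Icc a b)] fun t => ∫ s in Icc a b, k (t - s) • f s) :
    IsCompactOperator T := by
  have : CompleteSpace X := FiniteDimensional.complete ℝ X
  refine isClosed_setOfPred_isCompactOperator.closure_subset (Metric.mem_closure_iff.2 fun ε hε => ?_)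
  let μ := volume.restrict (Icc a b)
  have hε4 : 0 < ε / 4 := by positivity
  obtain ⟨φ, hφs, hφk, hφc, hφi⟩ := hk.exists_hasCompactSupport_lintegral_sub_le
    (ENNReal.ofReal_pos.2 hε4).ne'
  set L : ℝ := |b - a| + 1 with hL
  have hL0 : 0 < L := by positivity
  have hμL : μ univ ≤ ENNReal.ofReal L := by
    simp only [μ, Measure.restrict_apply_univ, Real.volume_Icc]
    exact ENNReal.ofReal_le_ofReal (by linarith [le_abs_self (b - a)])
  set η : ℝ := ε / 4 / L with hη
  have hη0 : 0 < η := by positivity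
  obtain ⟨δ, hδ, hδφ⟩ := Metric.uniformContinuous_iff.1
    (hφs.uniformContinuous_of_continuous hφc) η hη0
  obtain ⟨M, hM⟩ := hφc.bounded_above_of_compact_support hφs
  have hδ2 : 0 < δ / 2 := by positivity
  obtain ⟨S, hSc, hS⟩ := exists_isCompactOperator_grid (X := X) (p := p) a b hφc.measurable hM hδ2
  refine ⟨S, hSc, ?_⟩
  rw [dist_eq_norm]
  have hgrid : ∀ t, |t - δ / 2 * ⌊t / (δ / 2)⌋| < δ := by
    intro t
    have h1 := Int.floor_le (t / (δ / 2))
    have h2 := Int.lt_floor_add_one (t / (δ / 2))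
    rw [le_div_iff₀ hδ2] at h1
    rw [div_lt_iff₀ hδ2] at h2
    rw [abs_lt]
    constructor <;> nlinarith
  let κ : ℝ → ℝ≥0∞ := fun u => ‖k u - φ u‖ₑ
  have hκm : Measurable κ := (hkm.sub hφc.measurable).enorm
  have hconst : ∫⁻ _, ENNReal.ofReal η ∂μ ≤ ENNReal.ofReal (ε / 4) := by
    rw [lintegral_const]
    calc _ ≤ ENNReal.ofReal η * ENNReal.ofReal L := by gcongr
      _ = _ := by rw [← ENNReal.ofReal_mul hη0.le, hη, div_mul_cancel₀ _ hL0.ne']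
  have hsum : ENNReal.ofReal (ε / 4) + ENNReal.ofReal (ε / 4) = ENNReal.ofReal (ε / 2) := by
    rw [← ENNReal.ofReal_add hε4.le hε4.le]; congr 1; ring
  have hbound : ‖T - S‖ ≤ ε / 2 := by
    refine ContinuousLinearMap.opNorm_le_bound _ (by positivity) fun f => ?_
    refine Lp.norm_le_of_enorm_le_kernel hp' (K := fun t s => κ (t - s) + ENNReal.ofReal η)
      ((hκm.comp (measurable_fst.sub measurable_snd)).add_const _) (by positivity) ?_ ?_ f _ ?_
    · intro t
      rw [lintegral_add_right _ measurable_const, ← hsum]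
      refine add_le_add ((setLIntegral_le_lintegral _ _).trans ?_) hconst
      rwa [lintegral_sub_left_eq_self κ t]
    · intro s
      rw [lintegral_add_right _ measurable_const, ← hsum]
      refine add_le_add ((setLIntegral_le_lintegral _ _).trans ?_) hconst
      rwa [lintegral_sub_right_eq_self κ s]
    · have hfi : Integrable f μ :=
        memLp_one_iff_integrable.1 ((Lp.memLp f).mono_exponent hp.out)
      have hex := hfi.ae_convolution_exists (ContinuousLinearMap.lsmul ℝ ℝ).flip hk
      filter_upwards [hT f, hS f, Lp.coeFn_sub (T f) (S f), ae_restrict_of_ae hex]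
        with t hTt hSt hsub hkt
      have hkt' : Integrable (fun s => k (t - s) • f s) μ := by
        simpa [ConvolutionExistsAt] using hkt
      have hφt : Integrable (fun s => φ (δ / 2 * ⌊t / (δ / 2)⌋ - s) • f s) μ :=
        hfi.bdd_smul M
          (hφc.comp (continuous_const.sub continuous_id)).aestronglyMeasurable
          (.of_forall fun s => hM _)
      rw [sub_apply, hsub, Pi.sub_apply, hTt, hSt, ← integral_sub hkt' hφt]
      refine (enorm_integral_le_lintegral_enorm _).trans (lintegral_mono fun s => ?_)
      rw [← sub_smul, enorm_smul]
      gcongr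
      have hsplit : k (t - s) - φ (δ / 2 * ⌊t / (δ / 2)⌋ - s) = (k (t - s) - φ (t - s)) +
          (φ (t - s) - φ (δ / 2 * ⌊t / (δ / 2)⌋ - s)) := by ring
      rw [hsplit]
      refine (enorm_add_le _ _).trans (add_le_add le_rfl ?_)
      rw [← ofReal_norm]
      refine ENNReal.ofReal_le_ofReal ?_
      rw [← dist_eq_norm]
      refine (hδφ ?_).le
      rw [Real.dist_eq]
      convert hgrid t using 2
      ring
  linarith

/-- The convolution kernel of the Riemann-Liouville integral, truncated to `[0, L]`. -/
noncomputable def rlKernel (β L : ℝ) : ℝ → ℝ :=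
  (Icc 0 L).indicator fun u => (Real.Gamma β)⁻¹ * u ^ (β - 1)

theorem measurable_rlKernel (β L : ℝ) : Measurable (rlKernel β L) :=
  ((measurable_id.pow_const _).const_mul _).indicator measurableSet_Icc

theorem integrable_rlKernel {β L : ℝ} (hβ : 0 < β) (hL : 0 ≤ L) :
    Integrable (rlKernel β L) := by
  refine (integrable_indicator_iff measurableSet_Icc).2 (Integrable.const_mul ?_ _)
  have := intervalIntegral.intervalIntegrable_rpow' (a := 0) (b := L) (r := β - 1) (by linarith)
  exact (intervalIntegrable_iff_integrableOn_Icc_of_le hL).1 this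

theorem norm_rlKernel_le {β L : ℝ} (hβ : 1 ≤ β) (hL : 0 ≤ L) (u : ℝ) :
    ‖rlKernel β L u‖ ≤ ‖(Real.Gamma β)⁻¹‖ * L ^ (β - 1) := by
  by_cases hu : u ∈ Icc 0 L
  · rw [rlKernel, indicator_of_mem hu, norm_mul, Real.norm_of_nonneg (Real.rpow_nonneg hu.1 _)]
    gcongr
    exacts [hu.1, hu.2]
  · rw [rlKernel, indicator_of_notMem hu, norm_zero]
    positivity

theorem RL_eq_setIntegral_s8 {β a b t : ℝ} (ht : t ∈ Icc a b) (f : ℝ → X) :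
    RL β a f t = ∫ s in Icc a b, rlKernel β (b - a) (t - s) • f s := by
  have hker : ∀ s ∈ Icc a b, rlKernel β (b - a) (t - s) • f s =
      (Icc a t).indicator (fun s => (Real.Gamma β)⁻¹ • (t - s) ^ (β - 1) • f s) s := by
    intro s hs
    by_cases hst : s ≤ t
    · have hmem : t - s ∈ Icc 0 (b - a) := ⟨by linarith, by linarith [ht.2, hs.1]⟩
      rw [rlKernel, indicator_of_mem hmem, indicator_of_mem (show s ∈ Icc a t from ⟨hs.1, hst⟩),
        smul_smul]
    · have hnot : t - s ∉ Icc 0 (b - a) := fun h => hst (by linarith [h.1])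
      rw [rlKernel, indicator_of_notMem hnot,
        indicator_of_notMem (show s ∉ Icc a t from fun h => hst h.2), zero_smul]
  rw [setIntegral_congr_fun measurableSet_Icc hker, setIntegral_indicator measurableSet_Icc,
    inter_eq_self_of_subset_right (Icc_subset_Icc_right ht.2), RL,
    intervalIntegral.integral_of_le ht.1, integral_smul, integral_Icc_eq_integral_Ioc]

theorem RL_congr_ae {β a b t : ℝ} (ht : t ∈ Icc a b) {f g : ℝ → X}
    (h : f =ᵐ[volume.restrict (Icc a b)] g) : RL β a f t = RL β a g t := by
  rw [RL_eq_setIntegral_s8 ht, RL_eq_setIntegral_s8 ht]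
  refine integral_congr_ae ?_
  filter_upwards [h] with s hs
  rw [hs]

theorem RL_const [CompleteSpace X] {β a t : ℝ} (hβ : 0 < β) (x : X) :
    RL β a (fun _ => x) t = ((t - a) ^ β / Real.Gamma (β + 1)) • x := by
  rw [RL, intervalIntegral.integral_smul_const, smul_smul,
    intervalIntegral.integral_comp_sub_left (fun u => u ^ (β - 1)) t, sub_self,
    integral_rpow (Or.inl (by linarith)), sub_add_cancel, Real.zero_rpow hβ.ne', sub_zero,
    Real.Gamma_add_one hβ.ne']
  congr 1
  field_simp

/-- On a finite interval, the value at a point of a Riemann-Liouville integral of order at least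
one is a bounded functional on `Lᵖ`. -/
theorem exists_clm_eq_RL [CompleteSpace X] [Fact (1 ≤ p)] {β a b t : ℝ} (hβ : 1 ≤ β)
    (ht : t ∈ Icc a b) :
    ∃ B : Lp X p (volume.restrict (Icc a b)) →L[ℝ] X,
      ∀ f : Lp X p (volume.restrict (Icc a b)), B f = RL β a (f : ℝ → X) t := by
  obtain ⟨B, hB⟩ := Lp.exists_clm_eq_integral_smul (X := X) (p := p)
    (μ := volume.restrict (Icc a b)) (w := fun s => rlKernel β (b - a) (t - s))
    ((measurable_rlKernel β (b - a)).comp (measurable_const.sub measurable_id))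
    (.of_forall fun s => norm_rlKernel_le hβ (sub_nonneg.2 (ht.1.trans ht.2)) _)
  exact ⟨B, fun f => by rw [hB, RL_eq_setIntegral_s8 ht]⟩

/-- A Banach space carrying a compact nonzero multiple of the identity is finite-dimensional. -/
theorem finiteDimensional_of_isCompactOperator_smul {c : ℝ} (hc : c ≠ 0)
    (h : IsCompactOperator fun x : X => c • x) : FiniteDimensional ℝ X := by
  refine FiniteDimensional.of_isCompactOperator_id (𝕜 := ℝ) ?_
  have hid : (id : X → X) = c⁻¹ • fun x => c • x := by
    funext x
    simp [smul_smul, hc]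
  rw [hid]
  exact h.smul c⁻¹

/-- A compact Riemann-Liouville operator of positive order forces `X` to be finite-dimensional. -/
theorem finiteDimensional_of_isCompactOperator_RL [CompleteSpace X] [Fact (1 ≤ p)] {a b α : ℝ}
    (hab : a < b) (hα : 0 < α)
    (T : Lp X p (volume.restrict (Icc a b)) →L[ℝ] Lp X p (volume.restrict (Icc a b)))
    (hT : ∀ f : Lp X p (volume.restrict (Icc a b)),
      (T f : ℝ → X) =ᵐ[volume.restrict (Icc a b)] RL α a (f : ℝ → X))
    (h : IsCompactOperator T) : FiniteDimensional ℝ X := by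
  obtain ⟨D, hD⟩ := exists_clm_eq_RL (X := X) (p := p) (le_refl 1) (right_mem_Icc.2 hab.le)
  have hDT : ∀ x : X, D (T (Lp.constL p (volume.restrict (Icc a b)) ℝ x)) =
      (∫ t in Icc a b, (t - a) ^ α / Real.Gamma (α + 1)) • x := by
    intro x
    rw [hD, RL_congr_ae (right_mem_Icc.2 hab.le) (hT _), RL]
    simp only [sub_self, Real.rpow_zero, one_smul, Real.Gamma_one, inv_one]
    rw [intervalIntegral.integral_of_le hab.le, ← integral_Icc_eq_integral_Ioc,
      ← integral_smul_const]
    refine setIntegral_congr_fun measurableSet_Icc fun t ht => ?_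
    exact (RL_congr_ae ht (Lp.coeFn_const p _ x)).trans (RL_const hα x)
  have hpos : 0 < ∫ t in Icc a b, (t - a) ^ α / Real.Gamma (α + 1) := by
    rw [integral_Icc_eq_integral_Ioc, ← intervalIntegral.integral_of_le hab.le]
    refine intervalIntegral.intervalIntegral_pos_of_pos_on
      (Continuous.intervalIntegrable ?_ a b) (fun t ht => ?_) hab
    · exact ((continuous_id.sub continuous_const).rpow_const fun _ => Or.inr hα.le).div_const _
    · exact div_pos (Real.rpow_pos_of_pos (by linarith [ht.1]) _)
        (Real.Gamma_pos_of_pos (by linarith))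
  refine finiteDimensional_of_isCompactOperator_smul hpos.ne' ?_
  rw [← funext hDT]
  exact (h.comp_clm (Lp.constL p (volume.restrict (Icc a b)) ℝ)).clm_comp D

/-- Relative compactness of the increments of `J^{1+α}` on bounded sets forces `X` to be
finite-dimensional. -/
theorem finiteDimensional_of_isCompact_closure_RL [CompleteSpace X] [Fact (1 ≤ p)]
    {a b α s t : ℝ} (hα : 0 < α) (has : a < s) (hst : s < t) (htb : t < b)
    (h : ∀ F : Set (Lp X p (volume.restrict (Icc a b))), Bornology.IsBounded F →
      IsCompact (closure {x : X | ∃ f ∈ F,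
        x = RL (1 + α) a (f : ℝ → X) t - RL (1 + α) a (f : ℝ → X) s})) :
    FiniteDimensional ℝ X := by
  have hα1 : 0 < 1 + α := by linarith
  let c := (t - a) ^ (1 + α) / Real.Gamma (1 + α + 1) - (s - a) ^ (1 + α) / Real.Gamma (1 + α + 1)
  have hc : 0 < c := by
    have := Real.rpow_lt_rpow (by linarith) (sub_lt_sub_right hst a) hα1
    exact sub_pos.2 (div_lt_div_of_pos_right this (Real.Gamma_pos_of_pos (by linarith)))
  let C : X →L[ℝ] Lp X p (volume.restrict (Icc a b)) := Lp.constL p _ ℝ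
  refine finiteDimensional_of_isCompactOperator_smul hc.ne' ?_
  have hcl := h (C '' Metric.closedBall 0 1) (C.lipschitz.isBounded_image Metric.isBounded_closedBall)
  refine ⟨_, hcl, Filter.mem_of_superset (Metric.closedBall_mem_nhds 0 one_pos) fun x hx => ?_⟩
  refine subset_closure ⟨C x, mem_image_of_mem C hx, ?_⟩
  have hCx : C x =ᵐ[volume.restrict (Icc a b)] fun _ => x := Lp.coeFn_const p _ x
  rw [RL_congr_ae ⟨by linarith, by linarith⟩ hCx, RL_congr_ae ⟨by linarith, by linarith⟩ hCx]
  exact (sub_smul _ _ x).trans (congrArg₂ _ (RL_const hα1 x).symm (RL_const hα1 x).symm)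

end

/-- A bounded operator on `Lᵖ(t₀,t₁;X)` (with `1 ≤ p < ∞`) realizing the RL fractional
integral of order `α > 0` is compact iff for every bounded set `F ⊆ Lᵖ(t₀,t₁;X)` and all
`t₀ < t₀* < t₁* < t₁`, the set `{J^{1+α}f(t₁*) - J^{1+α}f(t₀*) : f ∈ F}` is relatively
compact in `X`. -/
theorem rl_isCompactOperator_iff {X : Type*} [NormedAddCommGroup X]
    [NormedSpace ℝ X] [CompleteSpace X]
    (t₀ t₁ α : ℝ) (ht : t₀ < t₁) (hα : 0 < α)
    (p : ℝ≥0∞) [Fact (1 ≤ p)] (hp' : p ≠ ⊤)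
    (T : Lp X p (volume.restrict (Set.Icc t₀ t₁)) →L[ℝ]
         Lp X p (volume.restrict (Set.Icc t₀ t₁)))
    (hT : ∀ f : Lp X p (volume.restrict (Set.Icc t₀ t₁)),
      (T f : ℝ → X) =ᵐ[volume.restrict (Set.Icc t₀ t₁)] RL α t₀ (f : ℝ → X)) :
    IsCompactOperator T ↔
      ∀ F : Set (Lp X p (volume.restrict (Set.Icc t₀ t₁))), Bornology.IsBounded F →
        ∀ t₀' t₁' : ℝ, t₀ < t₀' → t₀' < t₁' → t₁' < t₁ →
          IsCompact (closure {x : X | ∃ f ∈ F,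
            x = RL (1 + α) t₀ (f : ℝ → X) t₁' - RL (1 + α) t₀ (f : ℝ → X) t₀'}) := by
  constructor
  · intro h F hF t₀' t₁' h₀ h₀₁ h₁
    have : FiniteDimensional ℝ X := finiteDimensional_of_isCompactOperator_RL ht hα T hT h
    have : ProperSpace X := FiniteDimensional.proper ℝ X
    obtain ⟨B₁, hB₁⟩ := exists_clm_eq_RL (X := X) (p := p) (a := t₀) (b := t₁) (t := t₁')
      (β := 1 + α) (by linarith) ⟨by linarith, by linarith⟩
    obtain ⟨B₀, hB₀⟩ := exists_clm_eq_RL (X := X) (p := p) (a := t₀) (b := t₁) (t := t₀')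
      (β := 1 + α) (by linarith) ⟨by linarith, by linarith⟩
    refine (((B₁ - B₀).lipschitz.isBounded_image hF).subset ?_).isCompact_closure
    rintro x ⟨f, hf, rfl⟩
    exact ⟨f, hf, by rw [sub_apply, hB₁, hB₀]⟩
  · intro h
    have : FiniteDimensional ℝ X := by
      refine finiteDimensional_of_isCompact_closure_RL (p := p) (a := t₀) (b := t₁)
        (s := t₀ + (t₁ - t₀) / 3) (t := t₀ + 2 * (t₁ - t₀) / 3) hα ?_ ?_ ?_
        fun F hF => h F hF _ _ ?_ ?_ ?_
      all_goals linarith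
    refine isCompactOperator_of_convolution hp' (measurable_rlKernel α (t₁ - t₀))
      (integrable_rlKernel hα (sub_nonneg.2 ht.le)) T fun f => ?_
    filter_upwards [hT f, ae_restrict_mem measurableSet_Icc] with t htf htm
    rw [htf, RL_eq_setIntegral_s8 htm]
end
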